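/- arXiv:math/0006060 — 2 statements merged into one kernel-verified Lean document; each statement's English description precedes it below -/
import Mathlib

section
/- For every coassociative counital coalgebra C over a field k there is a long exact SBI-sequence relating Hochschild and cyclic cohomology: there exist k-linear maps S : HC^n(C) → HC^{n+2}(C), I : HC^{n+2}(C) → Hoch^{n+2}(C) and B : Hoch^{n+2}(C) → HC^{n+1}(C) for all n ≥ -2 (with HC^m(C) = 0 and Hoch^m(C) = 0 for m < 0) such that the sequence ⋯ → HC^n(C) →^S HC^{n+2}(C) →^I Hoch^{n+2}(C) →^B HC^{n+1}(C) →^S HC^{n+3}(C) → ⋯ is exact at every spot. -/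
open TensorProduct

universe u v

section CoalgebraInfra

variable (k : Type u) [Field k] (C : Type v) [AddCommGroup C] [Module k C] [Coalgebra k C]

noncomputable def TP : ℕ → ModuleCat.{v} k
  | 0 => ModuleCat.of k C
  | n + 1 => ModuleCat.of k (C ⊗[k] (TP n))

noncomputable def comulHead : (n : ℕ) → (TP k C n →ₗ[k] TP k C (n + 1))
  | 0 => show C →ₗ[k] C ⊗[k] C from Coalgebra.comul
  | n + 1 =>
      show (C ⊗[k] TP k C n) →ₗ[k] (C ⊗[k] (C ⊗[k] TP k C n)) from
        (TensorProduct.assoc k C C (TP k C n)).toLinearMap ∘ₗ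
          (LinearMap.rTensor (TP k C n) (Coalgebra.comul (R := k) (A := C)))

noncomputable def delta : (n : ℕ) → (i : ℕ) → (TP k C n →ₗ[k] TP k C (n + 1))
  | n, 0 => comulHead k C n
  | 0, _ + 1 => 0
  | n + 1, i + 1 =>
      show (C ⊗[k] TP k C n) →ₗ[k] (C ⊗[k] TP k C (n + 1)) from
        LinearMap.lTensor C (delta n i)

noncomputable def snocTP : (n : ℕ) → ((TP k C n) ⊗[k] C →ₗ[k] TP k C (n + 1))
  | 0 => show C ⊗[k] C →ₗ[k] C ⊗[k] C from LinearMap.id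
  | n + 1 =>
      show (C ⊗[k] TP k C n) ⊗[k] C →ₗ[k] (C ⊗[k] TP k C (n + 1)) from
        (LinearMap.lTensor C (snocTP n)) ∘ₗ (TensorProduct.assoc k C (TP k C n) C).toLinearMap

noncomputable def rotTP : (n : ℕ) → (TP k C n →ₗ[k] TP k C n)
  | 0 => LinearMap.id
  | n + 1 =>
      (snocTP k C n) ∘ₗ
        (show (C ⊗[k] TP k C n) →ₗ[k] ((TP k C n) ⊗[k] C) from
          (TensorProduct.comm k C (TP k C n)).toLinearMap)

noncomputable def cyclicT (n : ℕ) : TP k C n →ₗ[k] TP k C n :=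
  ((-1 : ℤ) ^ n) • rotTP k C n

noncomputable def normN (n : ℕ) : TP k C n →ₗ[k] TP k C n :=
  ∑ i ∈ Finset.range (n + 1), (cyclicT k C n) ^ i

noncomputable def bprime (n : ℕ) : TP k C n →ₗ[k] TP k C (n + 1) :=
  ∑ i ∈ Finset.range (n + 1), ((-1 : ℤ) ^ i) • delta k C n i

noncomputable def deltaTop (n : ℕ) : TP k C n →ₗ[k] TP k C (n + 1) :=
  ((-1 : ℤ) ^ (n + 1)) • (cyclicT k C (n + 1) ∘ₗ delta k C n 0)

noncomputable def bHoch (n : ℕ) : TP k C n →ₗ[k] TP k C (n + 1) :=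
  bprime k C n + ((-1 : ℤ) ^ (n + 1)) • deltaTop k C n

/-- The differential of the Hochschild complex arriving at degree `n`
(the zero map in degree `0`). -/
noncomputable def bHochPrev : (n : ℕ) → (TP k C (n - 1) →ₗ[k] TP k C n)
  | 0 => 0
  | n + 1 => bHoch k C n

/-- Hochschild cohomology `Hoch^n(C) = ker b_n / im b_{n-1}` of the coalgebra `C`. -/
noncomputable def HochMod (n : ℕ) : Type v :=
  ↥(LinearMap.ker (bHoch k C n)) ⧸
    Submodule.comap (LinearMap.ker (bHoch k C n)).subtype (LinearMap.range (bHochPrev k C n))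

noncomputable instance (n : ℕ) : AddCommGroup (HochMod k C n) :=
  inferInstanceAs (AddCommGroup (↥(LinearMap.ker (bHoch k C n)) ⧸
    Submodule.comap (LinearMap.ker (bHoch k C n)).subtype (LinearMap.range (bHochPrev k C n))))

noncomputable instance (n : ℕ) : Module k (HochMod k C n) :=
  inferInstanceAs (Module k (↥(LinearMap.ker (bHoch k C n)) ⧸
    Submodule.comap (LinearMap.ker (bHoch k C n)).subtype (LinearMap.range (bHochPrev k C n))))

/-- The degree-`n` part of the total complex of the cyclic bicomplex `CC^{p,q}(C)`:
`Tot^n = ⊕_{p+q=n, p,q ≥ 0} C^{⊗(q+1)}`. -/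
noncomputable def TotObj (n : ℕ) : Type v := ∀ p : Fin (n + 1), TP k C (n - p.val)

noncomputable instance (n : ℕ) : AddCommGroup (TotObj k C n) :=
  inferInstanceAs (AddCommGroup (∀ p : Fin (n + 1), TP k C (n - p.val)))

noncomputable instance (n : ℕ) : Module k (TotObj k C n) :=
  inferInstanceAs (Module k (∀ p : Fin (n + 1), TP k C (n - p.val)))

/-- Transport along an equality of indices. -/
noncomputable def pcast {a b : ℕ} (h : a = b) : TP k C a →ₗ[k] TP k C b := by
  subst h; exact LinearMap.id

/-- The vertical differential of the cyclic bicomplex: `b` in even columns,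
`b'` in odd columns. -/
noncomputable def vertD (p q : ℕ) : TP k C q →ₗ[k] TP k C (q + 1) :=
  if Even p then bHoch k C q else bprime k C q

/-- The horizontal differential of the cyclic bicomplex: `1 - T` out of even columns,
`N` out of odd columns. -/
noncomputable def horizD (p q : ℕ) : TP k C q →ₗ[k] TP k C q :=
  if Even p then LinearMap.id - cyclicT k C q else normN k C q

/-- The total differential of the cyclic bicomplex (with the sign `(-1)^p` on the vertical
differential in column `p`). -/
noncomputable def totD (n : ℕ) : TotObj k C n →ₗ[k] TotObj k C (n + 1) :=
  LinearMap.pi fun p' : Fin (n + 2) =>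
    (if h : p'.val ≤ n then
        (pcast k C (show (n - p'.val) + 1 = (n + 1) - p'.val by omega)) ∘ₗ
          (((-1 : ℤ) ^ p'.val) • vertD k C p'.val (n - p'.val)) ∘ₗ
          (LinearMap.proj (⟨p'.val, by omega⟩ : Fin (n + 1)))
      else 0) +
    (if h : 1 ≤ p'.val then
        (pcast k C (show n - (p'.val - 1) = (n + 1) - p'.val by
            have := p'.isLt; omega)) ∘ₗ
          (horizD k C (p'.val - 1) (n - (p'.val - 1))) ∘ₗ
          (LinearMap.proj (⟨p'.val - 1, by have := p'.isLt; omega⟩ : Fin (n + 1)))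
      else 0)

/-- The total differential arriving at degree `n` (the zero map in degree `0`). -/
noncomputable def totDPrev : (n : ℕ) → (TotObj k C (n - 1) →ₗ[k] TotObj k C n)
  | 0 => 0
  | n + 1 => totD k C n

/-- Cyclic cohomology `HC^n(C)`: the degree-`n` cohomology of the total complex of the
cyclic bicomplex. -/
noncomputable def HCMod (n : ℕ) : Type v :=
  ↥(LinearMap.ker (totD k C n)) ⧸
    Submodule.comap (LinearMap.ker (totD k C n)).subtype (LinearMap.range (totDPrev k C n))

noncomputable instance (n : ℕ) : AddCommGroup (HCMod k C n) :=
  inferInstanceAs (AddCommGroup (↥(LinearMap.ker (totD k C n)) ⧸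
    Submodule.comap (LinearMap.ker (totD k C n)).subtype (LinearMap.range (totDPrev k C n))))

noncomputable instance (n : ℕ) : Module k (HCMod k C n) :=
  inferInstanceAs (Module k (↥(LinearMap.ker (totD k C n)) ⧸
    Submodule.comap (LinearMap.ker (totD k C n)).subtype (LinearMap.range (totDPrev k C n))))

end CoalgebraInfra

section TensorPowers

variable {k : Type u} [Field k] {C : Type v} [AddCommGroup C] [Module k C]

/-- The bilinear map `(c, c₀ ⊗ ⋯ ⊗ cₙ) ↦ c ⊗ c₀ ⊗ ⋯ ⊗ cₙ`. -/
noncomputable def consTP (n : ℕ) : C →ₗ[k] TP k C n →ₗ[k] TP k C (n + 1) :=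
  show C →ₗ[k] TP k C n →ₗ[k] C ⊗[k] TP k C n from TensorProduct.mk k C (TP k C n)

/-- The map `id_C ⊗ f`. -/
noncomputable def consMap {n m : ℕ} (f : TP k C n →ₗ[k] TP k C m) :
    TP k C (n + 1) →ₗ[k] TP k C (m + 1) :=
  show C ⊗[k] TP k C n →ₗ[k] C ⊗[k] TP k C m from LinearMap.lTensor C f

/-- The bilinear map `(x ⊗ y, t) ↦ x ⊗ y ⊗ t`. -/
noncomputable def consPair (n : ℕ) : C ⊗[k] C →ₗ[k] TP k C n →ₗ[k] TP k C (n + 2) :=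
  TensorProduct.lift ((LinearMap.llcomp k (TP k C n) (TP k C (n + 1)) (TP k C (n + 2))
    |>.flip.comp (consTP n)).flip.comp (consTP (n + 1)))

theorem TP_ext {M : Type*} [AddCommGroup M] [Module k M] {n : ℕ}
    {f g : TP k C (n + 1) →ₗ[k] M}
    (h : ∀ c t, f (consTP n c t) = g (consTP n c t)) : f = g :=
  TensorProduct.ext' (M := C) (N := TP k C n) h

theorem consMap_consTP {n m : ℕ} (f : TP k C n →ₗ[k] TP k C m) (c : C) (t : TP k C n) :
    consMap f (consTP n c t) = consTP m c (f t) :=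
  LinearMap.lTensor_tmul C f c t

theorem consMap_sub {n m : ℕ} (f g : TP k C n →ₗ[k] TP k C m) :
    consMap (f - g) = consMap f - consMap g :=
  LinearMap.lTensor_sub f g

theorem consMap_comp {n m l : ℕ} (g : TP k C m →ₗ[k] TP k C l) (f : TP k C n →ₗ[k] TP k C m) :
    consMap (g ∘ₗ f) = consMap g ∘ₗ consMap f :=
  LinearMap.lTensor_comp C g f

theorem consPair_tmul (n : ℕ) (x y : C) (t : TP k C n) :
    consPair n (x ⊗ₜ[k] y) t = consTP (n + 1) x (consTP n y t) := rfl

/-- Two linear maps out of `C ⊗ C` that agree on pure tensors agree. -/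
theorem tmul_ext_apply {M : Type*} [AddCommGroup M] [Module k M] (f g : C ⊗[k] C →ₗ[k] M)
    (h : ∀ x y, f (x ⊗ₜ[k] y) = g (x ⊗ₜ[k] y)) (z : C ⊗[k] C) : f z = g z :=
  LinearMap.congr_fun (TensorProduct.ext' h) z

theorem consMap_consMap_consPair {n m : ℕ} (f : TP k C n →ₗ[k] TP k C m) (z : C ⊗[k] C)
    (t : TP k C n) : consMap (consMap f) (consPair n z t) = consPair m z (f t) :=
  tmul_ext_apply (consMap (consMap f) ∘ₗ (consPair n).flip t) ((consPair m).flip (f t))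
    (fun x y => by
      simp only [LinearMap.comp_apply, LinearMap.flip_apply, consPair_tmul, consMap_consTP]) z

end TensorPowers

section CounitContraction

variable {k : Type u} [Field k] {C : Type v} [AddCommGroup C] [Module k C] [Coalgebra k C]

/-- The contraction `c ⊗ t ↦ ε(c) t`. -/
noncomputable def counitHead (n : ℕ) : TP k C (n + 1) →ₗ[k] TP k C n :=
  show C ⊗[k] TP k C n →ₗ[k] TP k C n from
    TensorProduct.lift (LinearMap.lsmul k (TP k C n) ∘ₗ Coalgebra.counit (R := k) (A := C))

theorem counitHead_consTP (n : ℕ) (c : C) (t : TP k C n) :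
    counitHead n (consTP n c t) = Coalgebra.counit (R := k) c • t :=
  rfl

theorem delta_zero (n : ℕ) : delta k C n 0 = comulHead k C n := by
  cases n <;> rfl

theorem delta_succ (n i : ℕ) : delta k C (n + 1) (i + 1) = consMap (delta k C n i) := rfl

theorem comulHead_consTP (n : ℕ) (c : C) (t : TP k C n) :
    comulHead k C (n + 1) (consTP n c t) = consPair n (Coalgebra.comul (R := k) c) t :=
  tmul_ext_apply ((TensorProduct.assoc k C C (TP k C n)).toLinearMap ∘ₗ
    (TensorProduct.mk k (C ⊗[k] C) (TP k C n)).flip t) ((consPair n).flip t) (fun _ _ => rfl) _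

theorem comulHead_comp_consMap {n m : ℕ} (f : TP k C n →ₗ[k] TP k C m) :
    comulHead k C (m + 1) ∘ₗ consMap f = consMap (consMap f) ∘ₗ comulHead k C (n + 1) :=
  TP_ext fun c t => by
    simp only [LinearMap.comp_apply, consMap_consTP, comulHead_consTP, consMap_consMap_consPair]

theorem comulHead_comp_comulHead (n : ℕ) :
    comulHead k C (n + 1) ∘ₗ comulHead k C n =
      consMap (comulHead k C n) ∘ₗ comulHead k C n := by
  cases n with
  | zero => exact Coalgebra.coassoc (R := k) (A := C)
  | succ n =>
    refine TP_ext fun c t => ?_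
    simp only [LinearMap.comp_apply, comulHead_consTP]
    let Φ : C ⊗[k] (C ⊗[k] C) →ₗ[k] TP k C (n + 3) :=
      TensorProduct.lift ((LinearMap.llcomp k (C ⊗[k] C) (TP k C (n + 2)) (TP k C (n + 3))
        |>.flip ((consPair n).flip t)).comp (consTP (n + 2)))
    have h1 : ∀ z : C ⊗[k] C, comulHead k C (n + 2) (consPair n z t) =
        Φ (TensorProduct.assoc k C C C ((Coalgebra.comul (R := k)).rTensor C z)) := by
      intro z
      refine tmul_ext_apply (comulHead k C (n + 2) ∘ₗ (consPair n).flip t)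
        (Φ ∘ₗ (TensorProduct.assoc k C C C).toLinearMap ∘ₗ
          (Coalgebra.comul (R := k)).rTensor C) (fun x y => ?_) z
      simp only [LinearMap.comp_apply, LinearMap.flip_apply, consPair_tmul, comulHead_consTP,
        LinearMap.rTensor_tmul]
      exact tmul_ext_apply ((consPair (n + 1)).flip (consTP n y t))
        (Φ ∘ₗ (TensorProduct.assoc k C C C).toLinearMap ∘ₗ
          ((TensorProduct.mk k (C ⊗[k] C) C).flip y)) (fun a b => rfl) _
    have h2 : ∀ z : C ⊗[k] C, consMap (comulHead k C (n + 1)) (consPair n z t) =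
        Φ ((Coalgebra.comul (R := k)).lTensor C z) := by
      intro z
      refine tmul_ext_apply (consMap (comulHead k C (n + 1)) ∘ₗ (consPair n).flip t)
        (Φ ∘ₗ (Coalgebra.comul (R := k)).lTensor C) (fun x y => ?_) z
      simp only [LinearMap.comp_apply, LinearMap.flip_apply, consPair_tmul, comulHead_consTP,
        LinearMap.lTensor_tmul, consMap_consTP]
      rfl
    rw [h1, h2, Coalgebra.coassoc_apply]

theorem counitHead_comp_comulHead (n : ℕ) :
    counitHead n ∘ₗ comulHead k C n = LinearMap.id := by
  have h : ∀ c : C, TensorProduct.lid k C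
      ((Coalgebra.counit (R := k)).rTensor C (Coalgebra.comul (R := k) c)) = c := fun c => by
    rw [Coalgebra.rTensor_counit_comul, TensorProduct.lid_tmul, one_smul]
  cases n with
  | zero =>
    refine LinearMap.ext fun (c : C) => ?_
    refine Eq.trans ?_ (h c)
    exact tmul_ext_apply (counitHead (k := k) (C := C) 0)
      ((TensorProduct.lid k C).toLinearMap ∘ₗ (Coalgebra.counit (R := k)).rTensor C)
      (fun x y => rfl) _
  | succ n =>
    refine TP_ext fun c t => ?_
    rw [LinearMap.comp_apply, comulHead_consTP, LinearMap.id_apply]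
    conv_rhs => rw [← h c]
    refine tmul_ext_apply (counitHead (n + 1) ∘ₗ (consPair n).flip t)
      ((consTP n).flip t ∘ₗ (TensorProduct.lid k C).toLinearMap ∘ₗ
        (Coalgebra.counit (R := k)).rTensor C)
      (fun x y => ?_) _
    simp only [LinearMap.comp_apply, LinearMap.flip_apply, consPair_tmul, counitHead_consTP,
      LinearMap.rTensor_tmul, LinearEquiv.coe_coe, TensorProduct.lid_tmul, map_smul]

theorem counitHead_comp_consMap {n m : ℕ} (f : TP k C n →ₗ[k] TP k C m) :
    counitHead m ∘ₗ consMap f = f ∘ₗ counitHead n :=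
  TP_ext fun c t => by
    simp only [LinearMap.comp_apply, consMap_consTP, counitHead_consTP, map_smul]

theorem bprime_zero : bprime k C 0 = comulHead k C 0 := by
  simp [bprime, delta_zero]

theorem bprime_succ (n : ℕ) :
    bprime k C (n + 1) = comulHead k C (n + 1) - consMap (bprime k C n) := by
  refine TP_ext fun c t => ?_
  rw [bprime, Finset.sum_range_succ', LinearMap.add_apply, LinearMap.sub_apply, consMap_consTP,
    bprime, LinearMap.sum_apply, LinearMap.sum_apply, map_sum, sub_eq_neg_add,
    ← Finset.sum_neg_distrib, delta_zero, pow_zero, one_smul]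
  congr 1
  refine Finset.sum_congr rfl fun i _ => ?_
  rw [delta_succ, LinearMap.smul_apply, LinearMap.smul_apply, consMap_consTP, map_zsmul,
    pow_succ, mul_neg_one, neg_smul]

theorem consMap_bprime_comp_comulHead (n : ℕ) :
    consMap (bprime k C n) ∘ₗ comulHead k C n = comulHead k C (n + 1) ∘ₗ bprime k C n := by
  cases n with
  | zero => rw [bprime_zero, comulHead_comp_comulHead]
  | succ n =>
    rw [bprime_succ, consMap_sub, LinearMap.sub_comp, LinearMap.comp_sub,
      comulHead_comp_comulHead, comulHead_comp_consMap]

theorem bprime_comp_bprime (n : ℕ) : bprime k C (n + 1) ∘ₗ bprime k C n = 0 := by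
  induction n with
  | zero =>
    rw [bprime_succ, LinearMap.sub_comp, bprime_zero, comulHead_comp_comulHead, sub_self]
  | succ n ih =>
    have h0 : consMap (bprime k C (n + 1)) ∘ₗ consMap (bprime k C n) = 0 := by
      rw [← consMap_comp, ih]; exact LinearMap.lTensor_zero C
    rw [bprime_succ (n + 1), LinearMap.sub_comp, ← consMap_bprime_comp_comulHead,
      ← LinearMap.comp_sub]
    conv_lhs => enter [2]; rw [bprime_succ n, sub_sub_cancel]
    exact h0

theorem counitHead_comp_bprime_zero : counitHead 0 ∘ₗ bprime k C 0 = LinearMap.id := by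
  rw [bprime_zero, counitHead_comp_comulHead]

theorem counitHead_comp_bprime_succ (n : ℕ) :
    counitHead (n + 1) ∘ₗ bprime k C (n + 1) = LinearMap.id - bprime k C n ∘ₗ counitHead n := by
  rw [bprime_succ, LinearMap.comp_sub, counitHead_comp_comulHead, counitHead_comp_consMap]

end CounitContraction

section Rotation

variable {k : Type u} [Field k] {C : Type v} [AddCommGroup C] [Module k C]

/-- The bilinear map `(c, c₀ ⊗ ⋯ ⊗ cₙ) ↦ c₀ ⊗ ⋯ ⊗ cₙ ⊗ c`. -/
noncomputable def snocRight (n : ℕ) : C →ₗ[k] TP k C n →ₗ[k] TP k C (n + 1) :=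
  (TensorProduct.curry (snocTP k C n)).flip

/-- The bilinear map `(x ⊗ y, t) ↦ t ⊗ x ⊗ y`. -/
noncomputable def snocPair (n : ℕ) : C ⊗[k] C →ₗ[k] TP k C n →ₗ[k] TP k C (n + 2) :=
  TensorProduct.lift ((LinearMap.llcomp k (TP k C n) (TP k C (n + 1)) (TP k C (n + 2))
    ∘ₗ snocRight (n + 1)).flip.comp (snocRight n))

theorem rotTP_consTP_eq_snocRight (n : ℕ) (c : C) (t : TP k C n) :
    rotTP k C (n + 1) (consTP n c t) = snocRight n c t := rfl

theorem snocRight_consTP (n : ℕ) (a c : C) (t : TP k C n) :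
    snocRight (n + 1) a (consTP n c t) = consTP (n + 1) c (snocRight n a t) := rfl

theorem snocRight_succ (n : ℕ) (a : C) :
    snocRight (n + 1) a = consMap (snocRight (k := k) n a) :=
  TP_ext fun c t => by rw [snocRight_consTP, consMap_consTP]

theorem snocPair_succ (n : ℕ) (z : C ⊗[k] C) (c : C) (t : TP k C n) :
    snocPair (n + 1) z (consTP n c t) = consTP (n + 2) c (snocPair n z t) :=
  tmul_ext_apply ((snocPair (n + 1)).flip (consTP n c t))
    (consTP (n + 2) c ∘ₗ (snocPair n).flip t) (fun _ _ => rfl) z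

/-- The pure tensor `f 0 ⊗ ⋯ ⊗ f n`. -/
noncomputable def pureTP (k : Type u) [Field k] {C : Type v} [AddCommGroup C] [Module k C] :
    (n : ℕ) → (ℕ → C) → TP k C n
  | 0, f => show C from f 0
  | n + 1, f => consTP n (f 0) (pureTP k n fun i => f (i + 1))

theorem pureTP_congr {n : ℕ} {f g : ℕ → C} (h : ∀ i ≤ n, f i = g i) :
    pureTP k n f = pureTP k n g := by
  induction n generalizing f g with
  | zero => exact h 0 le_rfl
  | succ n ih =>
    rw [pureTP, pureTP, h 0 (Nat.zero_le _), ih fun i hi => h (i + 1) (by omega)]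

theorem pureTP_ext {M : Type*} [AddCommGroup M] [Module k M] {n : ℕ} {f g : TP k C n →ₗ[k] M}
    (h : ∀ x : ℕ → C, f (pureTP k n x) = g (pureTP k n x)) : f = g := by
  induction n with
  | zero => exact LinearMap.ext fun c => h fun _ => c
  | succ n ih =>
    refine TP_ext fun c t => ?_
    have key : f ∘ₗ consTP n c = g ∘ₗ consTP n c :=
      ih fun x => h fun i => Nat.casesOn (motive := fun _ => C) i c x
    exact LinearMap.congr_fun key t

theorem snocRight_pureTP (n : ℕ) (c : C) (f : ℕ → C) :
    snocRight n c (pureTP k n f) = pureTP k (n + 1) fun i => if i ≤ n then f i else c := by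
  induction n generalizing f with
  | zero => rfl
  | succ n ih =>
    rw [pureTP, snocRight_consTP, ih]
    refine congrArg (consTP (n + 1) (f 0)) (pureTP_congr fun i _ => ?_)
    simp only [Nat.add_le_add_iff_right]

theorem rotTP_pureTP (n : ℕ) (f : ℕ → C) :
    rotTP k C n (pureTP k n f) = pureTP k n fun i => f ((i + 1) % (n + 1)) := by
  cases n with
  | zero => rfl
  | succ n =>
    rw [pureTP, rotTP_consTP_eq_snocRight, snocRight_pureTP]
    refine pureTP_congr fun i hi => ?_
    split_ifs with h
    · rw [Nat.mod_eq_of_lt (by omega)]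
    · rw [show i + 1 = n + 1 + 1 by omega, Nat.mod_self]

theorem rotTP_pow_pureTP (n j : ℕ) (f : ℕ → C) :
    (rotTP k C n ^ j) (pureTP k n f) = pureTP k n fun i => f ((i + j) % (n + 1)) := by
  induction j with
  | zero =>
    refine pureTP_congr fun i hi => ?_
    rw [add_zero, Nat.mod_eq_of_lt (by omega)]
  | succ j ih =>
    rw [pow_succ', Module.End.mul_apply, ih, rotTP_pureTP]
    refine pureTP_congr fun i _ => ?_
    rw [Nat.mod_add_mod, show i + 1 + j = i + (j + 1) by omega]

theorem rotTP_pow_succ_self (n : ℕ) : rotTP k C n ^ (n + 1) = 1 :=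
  pureTP_ext fun f => by
    rw [rotTP_pow_pureTP, Module.End.one_apply]
    refine pureTP_congr fun i hi => ?_
    rw [Nat.add_mod_right, Nat.mod_eq_of_lt (by omega)]

theorem cyclicT_pow_succ_self (n : ℕ) : cyclicT k C n ^ (n + 1) = 1 := by
  rw [cyclicT, smul_pow, rotTP_pow_succ_self, ← pow_mul, (Nat.even_mul_succ_self n).neg_one_pow,
    one_smul]

theorem normN_mul_cyclicT (n : ℕ) : normN k C n * cyclicT k C n = normN k C n := by
  have h := geom_sum_mul (cyclicT k C n) (n + 1)
  rw [cyclicT_pow_succ_self, sub_self, mul_sub, mul_one] at h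
  exact sub_eq_zero.mp h

theorem cyclicT_mul_normN (n : ℕ) : cyclicT k C n * normN k C n = normN k C n := by
  have h := mul_geom_sum (cyclicT k C n) (n + 1)
  rw [cyclicT_pow_succ_self, sub_self, sub_mul, one_mul] at h
  exact sub_eq_zero.mp h

theorem normN_mul_cyclicT_pow (n j : ℕ) : normN k C n * cyclicT k C n ^ j = normN k C n := by
  induction j with
  | zero => rw [pow_zero, mul_one]
  | succ j ih => rw [pow_succ', ← mul_assoc, normN_mul_cyclicT, ih]

theorem normN_apply (n : ℕ) (t : TP k C n) :
    normN k C n t = ∑ i ∈ Finset.range (n + 1), (cyclicT k C n ^ i) t := by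
  rw [normN, LinearMap.sum_apply]

end Rotation

section CyclicIdentities

variable {k : Type u} [Field k] {C : Type v} [AddCommGroup C] [Module k C] [Coalgebra k C]

theorem snocRight_comp_delta {n i : ℕ} (hi : i ≤ n) (c : C) :
    snocRight (n + 1) c ∘ₗ delta k C n i = delta k C (n + 1) i ∘ₗ snocRight n c := by
  induction n generalizing i with
  | zero =>
    obtain rfl : i = 0 := by omega
    refine LinearMap.ext fun (a : C) => ?_
    exact tmul_ext_apply (snocRight 1 c) ((consPair 0).flip c) (fun _ _ => rfl)
      (Coalgebra.comul (R := k) a) |>.trans (comulHead_consTP 0 a c).symm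
  | succ n ih =>
    rw [snocRight_succ (n + 1)]
    cases i with
    | zero => rw [delta_zero, delta_zero, snocRight_succ n, comulHead_comp_consMap]
    | succ i =>
      rw [delta_succ, delta_succ, ← consMap_comp, ih (by omega), consMap_comp, ← snocRight_succ]

theorem delta_last_snocRight (n : ℕ) (c : C) (t : TP k C n) :
    delta k C (n + 1) (n + 1) (snocRight n c t) =
      snocPair n (Coalgebra.comul (R := k) c) t := by
  induction n with
  | zero =>
    exact tmul_ext_apply (consTP 1 (show C from t)) ((snocPair 0).flip t) (fun _ _ => rfl) _
  | succ n ih =>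
    suffices h : delta k C (n + 2) (n + 2) ∘ₗ snocRight (n + 1) c =
        snocPair (n + 1) (Coalgebra.comul (R := k) c) from LinearMap.congr_fun h t
    refine TP_ext fun a t => ?_
    rw [LinearMap.comp_apply, snocRight_consTP, delta_succ, consMap_consTP, ih, snocPair_succ]

theorem rotTP_comp_delta_succ {n i : ℕ} (hi : i + 1 ≤ n) :
    rotTP k C (n + 1) ∘ₗ delta k C n (i + 1) = delta k C n i ∘ₗ rotTP k C n := by
  obtain ⟨n, rfl⟩ : ∃ m, n = m + 1 := ⟨n - 1, by omega⟩
  refine TP_ext fun c t => ?_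
  rw [LinearMap.comp_apply, LinearMap.comp_apply, delta_succ, consMap_consTP,
    rotTP_consTP_eq_snocRight, rotTP_consTP_eq_snocRight]
  exact LinearMap.congr_fun (snocRight_comp_delta (by omega) c) t

theorem rotTP_rotTP_comulHead (n : ℕ) :
    rotTP k C (n + 1) ∘ₗ rotTP k C (n + 1) ∘ₗ comulHead k C n = delta k C n n ∘ₗ rotTP k C n := by
  cases n with
  | zero =>
    refine LinearMap.ext fun (a : C) => ?_
    exact tmul_ext_apply (rotTP k C 1 ∘ₗ rotTP k C 1) LinearMap.id (fun _ _ => rfl)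
      (Coalgebra.comul (R := k) a)
  | succ n =>
    refine TP_ext fun c t => ?_
    simp only [LinearMap.comp_apply]
    rw [comulHead_consTP, rotTP_consTP_eq_snocRight, delta_last_snocRight]
    exact tmul_ext_apply (rotTP k C (n + 2) ∘ₗ rotTP k C (n + 2) ∘ₗ (consPair n).flip t)
      ((snocPair n).flip t) (fun _ _ => rfl) _

/-- The coface `(-1)^i Δᵢ`. -/
noncomputable def signedCoface (k : Type u) [Field k] (C : Type v) [AddCommGroup C] [Module k C]
    [Coalgebra k C] (n i : ℕ) : TP k C n →ₗ[k] TP k C (n + 1) :=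
  ((-1 : ℤ) ^ i) • delta k C n i

theorem signedCoface_zero (n : ℕ) : signedCoface k C n 0 = comulHead k C n := by
  rw [signedCoface, pow_zero, one_smul, delta_zero]

theorem bprime_apply (n : ℕ) (t : TP k C n) :
    bprime k C n t = ∑ i ∈ Finset.range (n + 1), signedCoface k C n i t := by
  rw [bprime, LinearMap.sum_apply]; rfl

theorem bHoch_apply (n : ℕ) (t : TP k C n) :
    bHoch k C n t = bprime k C n t + cyclicT k C (n + 1) (comulHead k C n t) := by
  rw [bHoch, deltaTop, smul_smul, ← mul_pow, neg_one_mul, neg_neg, one_pow, one_smul, delta_zero]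
  rfl

theorem cyclicT_signedCoface_succ {n i : ℕ} (hi : i + 1 ≤ n) (t : TP k C n) :
    cyclicT k C (n + 1) (signedCoface k C n (i + 1) t) =
      signedCoface k C n i (cyclicT k C n t) := by
  have h := LinearMap.congr_fun (rotTP_comp_delta_succ (k := k) (C := C) hi) t
  simp only [LinearMap.comp_apply] at h
  simp only [cyclicT, signedCoface, LinearMap.smul_apply, map_zsmul, h, smul_smul]
  congr 1
  ring

theorem cyclicT_cyclicT_comulHead (n : ℕ) (t : TP k C n) :
    cyclicT k C (n + 1) (cyclicT k C (n + 1) (comulHead k C n t)) =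
      signedCoface k C n n (cyclicT k C n t) := by
  have h := LinearMap.congr_fun (rotTP_rotTP_comulHead (k := k) (C := C) n) t
  simp only [LinearMap.comp_apply] at h
  simp only [cyclicT, signedCoface, LinearMap.smul_apply, map_zsmul, h, smul_smul]
  congr 1
  ring

theorem bprime_cyclicT (n : ℕ) (t : TP k C n) :
    bprime k C n (cyclicT k C n t) =
      cyclicT k C (n + 1) (bHoch k C n t - comulHead k C n t) := by
  rw [bHoch_apply, bprime_apply, bprime_apply, Finset.sum_range_succ,
    Finset.sum_range_succ' _ n, signedCoface_zero, map_sub, map_add, map_add, map_sum,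
    cyclicT_cyclicT_comulHead, Finset.sum_congr rfl fun i hi =>
      cyclicT_signedCoface_succ (k := k) (C := C) (Finset.mem_range.mp hi) t]
  abel

theorem bprime_one_sub_cyclicT (n : ℕ) (t : TP k C n) :
    bprime k C n (t - cyclicT k C n t) = bHoch k C n t - cyclicT k C (n + 1) (bHoch k C n t) := by
  rw [map_sub, bprime_cyclicT, map_sub]
  nth_rewrite 2 [bHoch_apply]
  abel

theorem bHoch_bHoch (n : ℕ) (t : TP k C n) : bHoch k C (n + 1) (bHoch k C n t) = 0 := by
  have h1 := LinearMap.congr_fun (bprime_comp_bprime (k := k) (C := C) n) t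
  have h2 := bprime_cyclicT (n + 1) (comulHead k C n t)
  have h3 := LinearMap.congr_fun (consMap_bprime_comp_comulHead (k := k) (C := C) n) t
  have h4 := cyclicT_signedCoface_succ (n := n + 1) (i := 0) (by omega) (comulHead k C n t)
  have h5 := LinearMap.congr_fun (comulHead_comp_comulHead (k := k) (C := C) n) t
  have h6 : bprime k C (n + 1) (comulHead k C n t) =
      comulHead k C (n + 1) (comulHead k C n t) - comulHead k C (n + 1) (bprime k C n t) := by
    rw [bprime_succ, LinearMap.sub_apply]
    exact congrArg _ h3
  rw [signedCoface_zero, signedCoface, zero_add, pow_one, delta_succ, delta_zero, neg_one_smul,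
    LinearMap.neg_apply] at h4
  simp only [LinearMap.comp_apply, LinearMap.zero_apply] at h1 h5
  rw [← h5, map_neg] at h4
  rw [bHoch_apply, h6] at h2
  rw [bHoch_apply, bHoch_apply n]
  simp only [map_add, map_sub] at h2 ⊢
  rw [h1, h2, ← h4, map_neg]
  abel

theorem cyclicT_pow_signedCoface {n i : ℕ} (hi : i ≤ n) (t : TP k C n) :
    (cyclicT k C (n + 1) ^ i) (signedCoface k C n i t) =
      comulHead k C n ((cyclicT k C n ^ i) t) := by
  induction i generalizing t with
  | zero => rw [signedCoface_zero]; rfl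
  | succ i ih =>
    rw [pow_succ, Module.End.mul_apply, cyclicT_signedCoface_succ hi, ih (by omega), pow_succ,
      Module.End.mul_apply]

theorem normN_signedCoface {n i : ℕ} (hi : i ≤ n) (t : TP k C n) :
    normN k C (n + 1) (signedCoface k C n i t) =
      normN k C (n + 1) (comulHead k C n ((cyclicT k C n ^ i) t)) := by
  rw [← cyclicT_pow_signedCoface hi, ← Module.End.mul_apply, normN_mul_cyclicT_pow]

theorem normN_bprime (n : ℕ) (t : TP k C n) :
    normN k C (n + 1) (bprime k C n t) =
      normN k C (n + 1) (comulHead k C n (normN k C n t)) := by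
  rw [bprime_apply, normN_apply n, map_sum, map_sum, map_sum]
  exact Finset.sum_congr rfl fun i hi => normN_signedCoface (by simpa [Nat.lt_succ_iff] using hi) t

theorem signedCoface_normN {n j : ℕ} (hj : j ≤ n) (t : TP k C n) :
    signedCoface k C n (n - j) (normN k C n t) =
      (cyclicT k C (n + 1) ^ (j + 2)) (comulHead k C n (normN k C n t)) := by
  have hT : cyclicT k C n (normN k C n t) = normN k C n t :=
    LinearMap.congr_fun (cyclicT_mul_normN n) t
  induction j with
  | zero =>
    rw [zero_add, pow_two, Module.End.mul_apply, cyclicT_cyclicT_comulHead, hT, Nat.sub_zero]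
  | succ j ih =>
    rw [pow_succ', Module.End.mul_apply, ← ih (by omega),
      show n - j = n - (j + 1) + 1 by omega, cyclicT_signedCoface_succ (by omega), hT]

theorem bHoch_normN (n : ℕ) (t : TP k C n) :
    bHoch k C n (normN k C n t) = normN k C (n + 1) (bprime k C n t) := by
  rw [normN_bprime, bHoch_apply, bprime_apply, ← Finset.sum_range_reflect]
  set x := comulHead k C n (normN k C n t) with hx
  have h : ∀ j ∈ Finset.range (n + 1), signedCoface k C n (n + 1 - 1 - j) (normN k C n t) =
      cyclicT k C (n + 1) ((cyclicT k C (n + 1) ^ (j + 1)) x) := fun j hj => by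
    rw [Nat.add_sub_cancel, signedCoface_normN (by simpa [Nat.lt_succ_iff] using hj),
      pow_succ', Module.End.mul_apply]
  rw [Finset.sum_congr rfl h, ← map_sum, ← map_add]
  have h2 : normN k C (n + 1) x =
      ∑ j ∈ Finset.range (n + 1), (cyclicT k C (n + 1) ^ (j + 1)) x + x := by
    rw [normN_apply, Finset.sum_range_succ']; rfl
  rw [← h2]
  exact LinearMap.congr_fun (cyclicT_mul_normN (n + 1)) x

end CyclicIdentities

section TotalComplex

variable {k : Type u} [Field k] {C : Type v} [AddCommGroup C] [Module k C]

theorem pcast_family {a b : ℕ} (h : a = b) (g : ∀ q, TP k C q) : pcast k C h (g a) = g b := by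
  subst h; rfl

theorem pcast_pcast {a b c : ℕ} (h : a = b) (h' : b = c) (x : TP k C a) :
    pcast k C h' (pcast k C h x) = pcast k C (h.trans h') x := by
  subst h; subst h'; rfl

theorem pcast_natural {e : ℕ} (f : ∀ q, TP k C q →ₗ[k] TP k C (q + e)) {a b : ℕ}
    (h : a + e = b + e) (h' : a = b) (x : TP k C a) :
    pcast k C h (f a x) = f b (pcast k C h' x) := by
  subst h'; rfl

/-- The component of the total complex in column `p` and row `q`; it is zero unless
`p + q = n`. -/
noncomputable def totComp (n p q : ℕ) : TotObj k C n →ₗ[k] TP k C q :=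
  if h : p + q = n then
    pcast k C (show n - p = q by omega) ∘ₗ
      (LinearMap.proj (⟨p, by omega⟩ : Fin (n + 1)) :
        (∀ p : Fin (n + 1), TP k C (n - p.val)) →ₗ[k] _)
  else 0

theorem totComp_apply {n p q : ℕ} (h : p + q = n) (x : TotObj k C n) :
    totComp n p q x =
      pcast k C (show n - p = q by omega) (x (⟨p, by omega⟩ : Fin (n + 1))) := by
  rw [totComp, dif_pos h]; rfl

theorem totComp_ext {n : ℕ} {x y : TotObj k C n}
    (h : ∀ p q, p + q = n → totComp n p q x = totComp n p q y) : x = y := by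
  refine funext fun p => ?_
  have hp : p.val + (n - p.val) = n := by have := p.isLt; omega
  have := h p.val (n - p.val) hp
  rw [totComp_apply hp, totComp_apply hp] at this
  exact this

/-- The linear map into the total complex with prescribed components. -/
noncomputable def totMk {M : Type*} [AddCommGroup M] [Module k M] (n : ℕ)
    (f : ∀ _ q : ℕ, M →ₗ[k] TP k C q) : M →ₗ[k] TotObj k C n :=
  (LinearMap.pi fun p : Fin (n + 1) => f p.val (n - p.val) :
    M →ₗ[k] ∀ p : Fin (n + 1), TP k C (n - p.val))

theorem totComp_totMk {M : Type*} [AddCommGroup M] [Module k M] {n p q : ℕ} (h : p + q = n)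
    (f : ∀ _ q : ℕ, M →ₗ[k] TP k C q) (x : M) : totComp n p q (totMk n f x) = f p q x := by
  rw [totComp_apply h]
  exact pcast_family (show n - p = q by omega) fun q => f p q x

/-- The inclusion of the spot in column `p₀` and row `q₀` into the total complex. -/
noncomputable def totSingle (n p₀ q₀ : ℕ) : TP k C q₀ →ₗ[k] TotObj k C n :=
  totMk n fun p q => if h : p = p₀ ∧ q₀ = q then pcast k C h.2 else 0

theorem totComp_totSingle_self {n p q : ℕ} (h : p + q = n) (t : TP k C q) :
    totComp n p q (totSingle n p q t) = t := by
  rw [totSingle, totComp_totMk h, dif_pos ⟨rfl, rfl⟩]; rfl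

theorem totComp_totSingle_of_ne {n p q p₀ q₀ : ℕ} (h : p + q = n) (hp : p ≠ p₀) (t : TP k C q₀) :
    totComp n p q (totSingle n p₀ q₀ t) = 0 := by
  rw [totSingle, totComp_totMk h, dif_neg fun h => hp h.1]; rfl

/-- The inclusion of the total complex, shifted by two columns. -/
noncomputable def totShift (n : ℕ) : TotObj k C n →ₗ[k] TotObj k C (n + 2) :=
  totMk (n + 2) fun p q => if 2 ≤ p then totComp n (p - 2) q else 0

/-- The projection onto the columns `p ≥ 2`, reindexed to start at column zero. -/
noncomputable def totUnshift (n : ℕ) : TotObj k C (n + 2) →ₗ[k] TotObj k C n :=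
  totMk n fun p q => totComp (n + 2) (p + 2) q

theorem totComp_totShift_of_lt {n p q : ℕ} (h : p + q = n + 2) (hp : p < 2) (x : TotObj k C n) :
    totComp (n + 2) p q (totShift n x) = 0 := by
  rw [totShift, totComp_totMk h, if_neg (by omega)]; rfl

theorem totComp_totShift {n p q : ℕ} (h : p + q = n) (x : TotObj k C n) :
    totComp (n + 2) (p + 2) q (totShift n x) = totComp n p q x := by
  rw [totShift, totComp_totMk (by omega), if_pos (by omega)]; rfl

theorem totComp_totUnshift {n p q : ℕ} (h : p + q = n) (x : TotObj k C (n + 2)) :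
    totComp n p q (totUnshift n x) = totComp (n + 2) (p + 2) q x := by
  rw [totUnshift, totComp_totMk h]

theorem totUnshift_totShift (n : ℕ) (x : TotObj k C n) : totUnshift n (totShift n x) = x :=
  totComp_ext fun p q h => by rw [totComp_totUnshift h, totComp_totShift h]

theorem totShift_totUnshift {n : ℕ} {x : TotObj k C (n + 2)}
    (h0 : totComp (n + 2) 0 (n + 2) x = 0) (h1 : totComp (n + 2) 1 (n + 1) x = 0) :
    totShift n (totUnshift n x) = x :=
  totComp_ext fun p q h => by
    match p, h with
    | 0, h =>
      obtain rfl : q = n + 2 := by omega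
      rw [totComp_totShift_of_lt h (by omega), h0]
    | 1, h =>
      obtain rfl : q = n + 1 := by omega
      rw [totComp_totShift_of_lt h (by omega), h1]
    | p + 2, h =>
      rw [totComp_totShift (by omega), totComp_totUnshift (by omega)]

theorem totShift_injective (n : ℕ) : Function.Injective (totShift (k := k) (C := C) n) :=
  Function.LeftInverse.injective (totUnshift_totShift n)

theorem horizD_zero_apply (n : ℕ) (t : TP k C n) : horizD k C 0 n t = t - cyclicT k C n t := by
  rw [horizD, if_pos Even.zero]; rfl

theorem horizD_one (n : ℕ) : horizD k C 1 n = normN k C n := by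
  rw [horizD, if_neg (by decide)]

theorem horizD_add_two (p n : ℕ) : horizD k C (p + 2) n = horizD k C p n := by
  simp only [horizD, Nat.even_add, even_two, iff_true]

theorem horizD_zero_zero : horizD k C 0 0 = 0 := by
  refine LinearMap.ext fun t => ?_
  rw [horizD_zero_apply, cyclicT, pow_zero, one_smul]
  exact sub_self t

theorem normN_horizD_zero (n : ℕ) (t : TP k C n) : normN k C n (horizD k C 0 n t) = 0 := by
  rw [horizD_zero_apply, map_sub, sub_eq_zero]
  exact (LinearMap.congr_fun (normN_mul_cyclicT n) t).symm

theorem horizD_zero_normN (n : ℕ) (t : TP k C n) : horizD k C 0 n (normN k C n t) = 0 := by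
  rw [horizD_zero_apply, sub_eq_zero]
  exact (LinearMap.congr_fun (cyclicT_mul_normN n) t).symm

end TotalComplex

section TotalDifferential

variable {k : Type u} [Field k] {C : Type v} [AddCommGroup C] [Module k C] [Coalgebra k C]

theorem vertD_zero (n : ℕ) : vertD k C 0 n = bHoch k C n := by
  rw [vertD, if_pos Even.zero]

theorem vertD_one (n : ℕ) : vertD k C 1 n = bprime k C n := by
  rw [vertD, if_neg (by decide)]

theorem vertD_add_two (p n : ℕ) : vertD k C (p + 2) n = vertD k C p n := by
  simp only [vertD, Nat.even_add, even_two, iff_true]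

theorem totComp_totD_zero (n : ℕ) (x : TotObj k C n) :
    totComp (n + 1) 0 (n + 1) (totD k C n x) = bHoch k C n (totComp n 0 n x) := by
  rw [totComp_apply (by omega), totComp_apply (by omega), totD]
  change pcast k C _ ((dite _ _ _ + dite _ _ _ : _ →ₗ[k] _) x) = _
  rw [dif_pos (Nat.zero_le n), dif_neg (by simp), add_zero]
  simp only [LinearMap.comp_apply, pow_zero, one_smul, vertD_zero]
  rfl

theorem totComp_totD_succ_succ {n p q : ℕ} (h : p + q + 1 = n) (x : TotObj k C n) :
    totComp (n + 1) (p + 1) (q + 1) (totD k C n x) =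
      ((-1 : ℤ) ^ (p + 1)) • vertD k C (p + 1) q (totComp n (p + 1) q x) +
        horizD k C p (q + 1) (totComp n p (q + 1) x) := by
  rw [totComp_apply (by omega), totComp_apply (by omega), totComp_apply (by omega), totD]
  change pcast k C _ ((dite _ _ _ + dite _ _ _ : _ →ₗ[k] _) x) = _
  rw [dif_pos (show p + 1 ≤ n by omega), dif_pos (show 1 ≤ p + 1 by omega), LinearMap.add_apply,
    map_add]
  change pcast k C _ (pcast k C _
      (((-1 : ℤ) ^ (p + 1)) • vertD k C (p + 1) (n - (p + 1)) (x ⟨p + 1, by omega⟩))) +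
    pcast k C _ (pcast k C (show n - p = n + 1 - (p + 1) by omega)
      (horizD k C p (n - p) (x ⟨p, by omega⟩))) = _
  rw [map_zsmul, map_zsmul, pcast_pcast, pcast_pcast, pcast_natural (e := 1) (vertD k C (p + 1)) _ (show n - (p + 1) = q by omega),
    pcast_natural (e := 0) (horizD k C p) _ (show n - p = q + 1 by omega)]

theorem totComp_totD_last (n : ℕ) (x : TotObj k C n) :
    totComp (n + 1) (n + 1) 0 (totD k C n x) = horizD k C n 0 (totComp n n 0 x) := by
  rw [totComp_apply (by omega), totComp_apply (by omega), totD]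
  change pcast k C _ ((dite _ _ _ + dite _ _ _ : _ →ₗ[k] _) x) = _
  rw [dif_neg (show ¬ n + 1 ≤ n by omega), dif_pos (show 1 ≤ n + 1 by omega), zero_add]
  change pcast k C _ (pcast k C (show n - n = n + 1 - (n + 1) by omega)
    (horizD k C n (n - n) (x ⟨n, by omega⟩))) = _
  rw [pcast_pcast, pcast_natural (e := 0) (horizD k C n) _ (show n - n = 0 by omega)]

theorem totComp_totD_one (n : ℕ) (x : TotObj k C (n + 1)) :
    totComp (n + 2) 1 (n + 1) (totD k C (n + 1) x) =
      horizD k C 0 (n + 1) (totComp (n + 1) 0 (n + 1) x) -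
        bprime k C n (totComp (n + 1) 1 n x) := by
  rw [totComp_totD_succ_succ (p := 0) (q := n) (by omega), zero_add, pow_one, neg_one_smul,
    vertD_one, sub_eq_neg_add]

theorem totComp_totD_two_zero (x : TotObj k C 1) :
    totComp 2 2 0 (totD k C 1 x) = normN k C 0 (totComp 1 1 0 x) := by
  rw [totComp_totD_last, horizD_one]

theorem totComp_totD_two_succ (n : ℕ) (x : TotObj k C (n + 2)) :
    totComp (n + 3) 2 (n + 1) (totD k C (n + 2) x) =
      bHoch k C n (totComp (n + 2) 2 n x) + normN k C (n + 1) (totComp (n + 2) 1 (n + 1) x) := by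
  rw [totComp_totD_succ_succ (p := 1) (q := n) (by omega), horizD_one, vertD_add_two, vertD_zero]
  simp

theorem totUnshift_totD_zero (x : TotObj k C 1) :
    totUnshift 0 (totD k C 1 x) = totSingle 0 0 0 (normN k C 0 (totComp 1 1 0 x)) :=
  totComp_ext fun p q h => by
    obtain rfl : p = 0 := by omega
    obtain rfl : q = 0 := by omega
    rw [totComp_totUnshift h, totComp_totSingle_self h, totComp_totD_two_zero]

theorem totUnshift_totD_succ (n : ℕ) (x : TotObj k C (n + 2)) :
    totUnshift (n + 1) (totD k C (n + 2) x) =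
      totD k C n (totUnshift n x) +
        totSingle (n + 1) 0 (n + 1) (normN k C (n + 1) (totComp (n + 2) 1 (n + 1) x)) :=
  totComp_ext fun p q h => by
    rw [totComp_totUnshift h, map_add]
    match p, q, h with
    | 0, q, h =>
      obtain rfl : q = n + 1 := by omega
      rw [totComp_totSingle_self h, totComp_totD_two_succ, totComp_totD_zero,
        totComp_totUnshift (by omega)]
    | p + 1, 0, h =>
      obtain rfl : p = n := by omega
      rw [totComp_totSingle_of_ne h (by omega), totComp_totD_last, totComp_totD_last,
        totComp_totUnshift (by omega), horizD_add_two, add_zero]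
    | p + 1, q + 1, h =>
      rw [totComp_totSingle_of_ne h (by omega), totComp_totD_succ_succ (p := p) (by omega),
        totComp_totD_succ_succ (p := p + 2) (by omega), totComp_totUnshift (by omega),
        totComp_totUnshift (by omega), horizD_add_two, add_zero, show p + 2 + 1 = p + 1 + 2 by rfl,
        vertD_add_two, pow_add _ (p + 1) 2, neg_one_sq, mul_one]

theorem totD_totShift (n : ℕ) (x : TotObj k C n) :
    totD k C (n + 2) (totShift n x) = totShift (n + 1) (totD k C n x) := by
  have h0 : totComp (n + 2) 0 (n + 2) (totShift n x) = 0 :=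
    totComp_totShift_of_lt (by omega) (by omega) x
  have h1 : totComp (n + 2) 1 (n + 1) (totShift n x) = 0 :=
    totComp_totShift_of_lt (by omega) (by omega) x
  rw [← totShift_totUnshift (x := totD k C (n + 2) (totShift n x)), totUnshift_totD_succ,
    totUnshift_totShift, h1, map_zero, map_zero, add_zero]
  · rw [totComp_totD_zero, h0, map_zero]
  · rw [totComp_totD_one, h0, h1, map_zero, map_zero, sub_zero]

theorem totD_totSingle_zero (n : ℕ) (t : TP k C n) :
    totD k C n (totSingle n 0 n t) =
      totSingle (n + 1) 0 (n + 1) (bHoch k C n t) +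
        totSingle (n + 1) 1 n (horizD k C 0 n t) :=
  totComp_ext fun p q h => by
    rw [map_add]
    match p, q, h with
    | 0, q, h =>
      obtain rfl : q = n + 1 := by omega
      rw [totComp_totD_zero, totComp_totSingle_self (by omega), totComp_totSingle_self h,
        totComp_totSingle_of_ne h (by omega), add_zero]
    | 1, 0, h =>
      obtain rfl : n = 0 := by omega
      rw [totComp_totD_last, totComp_totSingle_self (by omega), totComp_totSingle_self h,
        totComp_totSingle_of_ne h (by omega), zero_add]
    | 1, q + 1, h =>
      obtain rfl : n = q + 1 := by omega
      rw [totComp_totD_one, totComp_totSingle_self (by omega), totComp_totSingle_self h,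
        totComp_totSingle_of_ne h (by omega), totComp_totSingle_of_ne (by omega) (by omega),
        map_zero, zero_add, sub_zero]
    | p + 2, 0, h =>
      obtain rfl : n = p + 1 := by omega
      rw [totComp_totD_last, totComp_totSingle_of_ne (by omega) (by omega),
        totComp_totSingle_of_ne h (by omega), totComp_totSingle_of_ne h (by omega), map_zero,
        add_zero]
    | p + 2, q + 1, h =>
      rw [totComp_totD_succ_succ (p := p + 1) (by omega),
        totComp_totSingle_of_ne (by omega) (by omega),
        totComp_totSingle_of_ne (by omega) (by omega),
        totComp_totSingle_of_ne h (by omega), totComp_totSingle_of_ne h (by omega), map_zero,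
        map_zero, smul_zero]

theorem totD_totSingle_one (n : ℕ) (t : TP k C n) :
    totD k C (n + 1) (totSingle (n + 1) 1 n t) =
      totShift n (totSingle n 0 n (normN k C n t)) -
        totSingle (n + 2) 1 (n + 1) (bprime k C n t) := by
  have h0 : totComp (n + 1) 0 (n + 1) (totSingle (n + 1) 1 n t) = 0 :=
    totComp_totSingle_of_ne (by omega) (by omega) t
  have h1 : totComp (n + 1) 1 n (totSingle (n + 1) 1 n t) = t :=
    totComp_totSingle_self (by omega) t
  rw [eq_sub_iff_add_eq, ← totShift_totUnshift
    (x := totD k C (n + 1) (totSingle (n + 1) 1 n t) + totSingle (n + 2) 1 (n + 1) (bprime k C n t))]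
  · have h2 : totUnshift n (totSingle (n + 2) 1 (n + 1) (bprime k C n t)) = 0 :=
      totComp_ext fun p q h => by
        rw [totComp_totUnshift h, totComp_totSingle_of_ne (by omega) (by omega), map_zero]
    rw [map_add, h2, add_zero]
    cases n with
    | zero => rw [totUnshift_totD_zero, h1]
    | succ n =>
      have h3 : totUnshift n (totSingle (n + 2) 1 (n + 1) t) = 0 :=
        totComp_ext fun p q h => by
          rw [totComp_totUnshift h, totComp_totSingle_of_ne (by omega) (by omega), map_zero]
      rw [totUnshift_totD_succ, h1, h3, map_zero, zero_add]
  · rw [map_add, totComp_totD_zero, h0, totComp_totSingle_of_ne (by omega) (by omega), map_zero,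
      add_zero]
  · rw [map_add, totComp_totD_one, h0, h1, totComp_totSingle_self (by omega), map_zero, zero_sub,
      neg_add_cancel]

theorem bprime_horizD_zero (n : ℕ) (t : TP k C n) :
    bprime k C n (horizD k C 0 n t) = horizD k C 0 (n + 1) (bHoch k C n t) := by
  rw [horizD_zero_apply, bprime_one_sub_cyclicT, horizD_zero_apply]

end TotalDifferential

section Subquotient

variable {R : Type*} [Ring R] {A₀ A A₁ A₀' A' A₁' A₀'' A'' A₁'' : Type*}
  [AddCommGroup A₀] [AddCommGroup A] [AddCommGroup A₁]
  [AddCommGroup A₀'] [AddCommGroup A'] [AddCommGroup A₁']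
  [AddCommGroup A₀''] [AddCommGroup A''] [AddCommGroup A₁'']
  [Module R A₀] [Module R A] [Module R A₁] [Module R A₀'] [Module R A'] [Module R A₁']
  [Module R A₀''] [Module R A''] [Module R A₁'']

/-- The subquotient `ker d / im e`. -/
abbrev KerModRange (e : A₀ →ₗ[R] A) (d : A →ₗ[R] A₁) : Type _ :=
  ↥(LinearMap.ker d) ⧸ Submodule.comap (LinearMap.ker d).subtype (LinearMap.range e)

variable {e : A₀ →ₗ[R] A} {d : A →ₗ[R] A₁} {e' : A₀' →ₗ[R] A'} {d' : A' →ₗ[R] A₁'}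
  {e'' : A₀'' →ₗ[R] A''} {d'' : A'' →ₗ[R] A₁''}

/-- The map on subquotients induced by a map preserving cocycles and coboundaries. -/
noncomputable def kerModRangeMap (f : A →ₗ[R] A') (h : ∀ x, d x = 0 → d' (f x) = 0)
    (h' : ∀ y, f (e y) ∈ LinearMap.range e') : KerModRange e d →ₗ[R] KerModRange e' d' :=
  Submodule.mapQ _ _ (f.restrict (p := LinearMap.ker d) (q := LinearMap.ker d') h) (by
    rintro ⟨x, hx⟩ ⟨y, rfl⟩
    exact h' y)

theorem kerModRangeMap_ker_eq_bot {f : A →ₗ[R] A'} (h : ∀ x, d x = 0 → d' (f x) = 0)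
    (h' : ∀ y, f (e y) ∈ LinearMap.range e')
    (H : ∀ x, d x = 0 → f x ∈ LinearMap.range e' → x ∈ LinearMap.range e) :
    LinearMap.ker (kerModRangeMap f h h') = ⊥ := by
  rw [eq_bot_iff]
  intro q hq
  obtain ⟨⟨x, hx⟩, rfl⟩ := Submodule.Quotient.mk_surjective _ q
  have h1 := (Submodule.Quotient.mk_eq_zero _).mp (LinearMap.mem_ker.mp hq)
  exact (Submodule.Quotient.mk_eq_zero _).mpr (H x hx h1)

theorem kerModRangeMap_range_eq_top {f : A →ₗ[R] A'} (h : ∀ x, d x = 0 → d' (f x) = 0)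
    (h' : ∀ y, f (e y) ∈ LinearMap.range e')
    (H : ∀ y, d' y = 0 → ∃ x, d x = 0 ∧ y = f x) :
    LinearMap.range (kerModRangeMap f h h') = ⊤ := by
  rw [LinearMap.range_eq_top]
  intro q
  obtain ⟨⟨y, hy⟩, rfl⟩ := Submodule.Quotient.mk_surjective _ q
  obtain ⟨x, hx, rfl⟩ := H y hy
  exact ⟨Submodule.Quotient.mk ⟨x, hx⟩, rfl⟩

theorem kerModRangeMap_ker_eq_range {f : A →ₗ[R] A'} {g : A'' →ₗ[R] A}
    (hf : ∀ x, d x = 0 → d' (f x) = 0) (hf' : ∀ y, f (e y) ∈ LinearMap.range e')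
    (hg : ∀ x, d'' x = 0 → d (g x) = 0) (hg' : ∀ y, g (e'' y) ∈ LinearMap.range e)
    (H : ∀ y, d'' y = 0 → f (g y) ∈ LinearMap.range e')
    (H' : ∀ x, d x = 0 → f x ∈ LinearMap.range e' →
      ∃ y, d'' y = 0 ∧ x - g y ∈ LinearMap.range e) :
    LinearMap.ker (kerModRangeMap f hf hf') = LinearMap.range (kerModRangeMap g hg hg') := by
  refine le_antisymm (fun q hq => ?_) ?_
  · obtain ⟨⟨x, hx⟩, rfl⟩ := Submodule.Quotient.mk_surjective _ q
    have h1 := (Submodule.Quotient.mk_eq_zero _).mp (LinearMap.mem_ker.mp hq)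
    obtain ⟨y, hy, hxy⟩ := H' x hx h1
    refine ⟨Submodule.Quotient.mk ⟨y, hy⟩, Eq.symm ?_⟩
    exact (Submodule.Quotient.eq _).mpr hxy
  · rintro _ ⟨q, rfl⟩
    obtain ⟨⟨y, hy⟩, rfl⟩ := Submodule.Quotient.mk_surjective _ q
    exact (Submodule.Quotient.mk_eq_zero _).mpr (H y hy)

end Subquotient

section SBI

variable {k : Type u} [Field k] {C : Type v} [AddCommGroup C] [Module k C] [Coalgebra k C]

theorem bprime_counitHead_horizD {n : ℕ} {x : TP k C (n + 1)}
    (hx : bHoch k C (n + 1) x = 0) :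
    bprime k C n (counitHead n (horizD k C 0 (n + 1) x)) = horizD k C 0 (n + 1) x := by
  have h := LinearMap.congr_fun (counitHead_comp_bprime_succ (k := k) (C := C) n)
    (horizD k C 0 (n + 1) x)
  simp only [LinearMap.comp_apply, LinearMap.sub_apply, LinearMap.id_apply] at h
  rw [bprime_horizD_zero, hx, map_zero, map_zero, eq_comm, sub_eq_zero] at h
  exact h.symm

theorem bprime_counitHead {n : ℕ} {x : TP k C (n + 1)} (hx : bprime k C (n + 1) x = 0) :
    bprime k C n (counitHead n x) = x := by
  have h := LinearMap.congr_fun (counitHead_comp_bprime_succ (k := k) (C := C) n) x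
  simp only [LinearMap.comp_apply, LinearMap.sub_apply, LinearMap.id_apply] at h
  rw [hx, map_zero, eq_comm, sub_eq_zero] at h
  exact h.symm

theorem bprime_zero_injective : Function.Injective (bprime k C 0) :=
  Function.LeftInverse.injective
    (LinearMap.congr_fun (counitHead_comp_bprime_zero (k := k) (C := C)))

/-- Connes' operator `N s (1 - T)` on Hochschild cochains. -/
noncomputable def connesOperator (k : Type u) [Field k] (C : Type v) [AddCommGroup C] [Module k C]
    [Coalgebra k C] (n : ℕ) : TP k C (n + 1) →ₗ[k] TP k C n :=
  normN k C n ∘ₗ counitHead n ∘ₗ horizD k C 0 (n + 1)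

theorem totSingle_normN_counitHead_bprime (n : ℕ) (y : TP k C n) :
    totSingle n 0 n (normN k C n (counitHead n (bprime k C n y))) -
      totSingle n 0 n (normN k C n y) ∈ LinearMap.range (totDPrev k C n) := by
  cases n with
  | zero =>
    have h := LinearMap.congr_fun (counitHead_comp_bprime_zero (k := k) (C := C)) y
    rw [LinearMap.comp_apply, LinearMap.id_apply] at h
    rw [h, sub_self]
    exact zero_mem _
  | succ n =>
    have h := LinearMap.congr_fun (counitHead_comp_bprime_succ (k := k) (C := C) n) y
    simp only [LinearMap.comp_apply, LinearMap.sub_apply, LinearMap.id_apply] at h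
    refine ⟨-totSingle n 0 n (normN k C n (counitHead n y)), ?_⟩
    rw [map_neg]
    refine (congrArg Neg.neg (totD_totSingle_zero n _)).trans ?_
    rw [h, horizD_zero_normN, map_zero, add_zero, map_sub, map_sub, bHoch_normN]
    abel

theorem totUnshift_totD_sub_mem (n : ℕ) (z : TotObj k C (n + 1)) :
    totUnshift n (totD k C (n + 1) z) -
      totSingle n 0 n (normN k C n (totComp (n + 1) 1 n z)) ∈
        LinearMap.range (totDPrev k C n) := by
  cases n with
  | zero =>
    rw [totUnshift_totD_zero, sub_self]
    exact zero_mem _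
  | succ n =>
    rw [totUnshift_totD_succ, add_sub_cancel_right]
    exact ⟨totUnshift n z, rfl⟩

theorem totD_totSingle_normN (n : ℕ) (y : TP k C n) :
    totD k C n (totSingle n 0 n (normN k C n y)) =
      totSingle (n + 1) 0 (n + 1) (normN k C (n + 1) (bprime k C n y)) := by
  rw [totD_totSingle_zero, horizD_zero_normN, map_zero, add_zero, bHoch_normN]

theorem totD_totSingle_connesOperator {n : ℕ} {x : TP k C (n + 1)}
    (hx : bHoch k C (n + 1) x = 0) :
    totD k C n (totSingle n 0 n (connesOperator k C n x)) = 0 := by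
  rw [connesOperator, LinearMap.comp_apply, LinearMap.comp_apply, totD_totSingle_normN,
    bprime_counitHead_horizD hx, normN_horizD_zero, map_zero]

/-- A Hochschild cocycle lifts to columns zero and one of the cyclic bicomplex, with total
differential Connes' operator in column two. -/
theorem totD_lift {n : ℕ} {x : TP k C (n + 1)} (hx : bHoch k C (n + 1) x = 0) :
    totD k C (n + 1) (totSingle (n + 1) 0 (n + 1) x +
      totSingle (n + 1) 1 n (counitHead n (horizD k C 0 (n + 1) x))) =
        totShift n (totSingle n 0 n (connesOperator k C n x)) := by
  rw [map_add, totD_totSingle_zero, totD_totSingle_one, bprime_counitHead_horizD hx, hx, map_zero,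
    zero_add, add_sub_cancel]
  rfl

theorem bHoch_totComp_zero {n : ℕ} {x : TotObj k C n} (hx : totD k C n x = 0) :
    bHoch k C n (totComp n 0 n x) = 0 := by
  rw [← totComp_totD_zero, hx, map_zero]

theorem horizD_totComp_zero {n : ℕ} {x : TotObj k C (n + 1)}
    (hx : totComp (n + 2) 1 (n + 1) (totD k C (n + 1) x) = 0) :
    horizD k C 0 (n + 1) (totComp (n + 1) 0 (n + 1) x) =
      bprime k C n (totComp (n + 1) 1 n x) := by
  rw [totComp_totD_one, sub_eq_zero] at hx
  exact hx

theorem totSingle_connesOperator_sub_mem {n : ℕ} {x : TotObj k C (n + 1)}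
    (hx : totComp (n + 2) 1 (n + 1) (totD k C (n + 1) x) = 0) :
    totSingle n 0 n (connesOperator k C n (totComp (n + 1) 0 (n + 1) x)) -
      totUnshift n (totD k C (n + 1) x) ∈ LinearMap.range (totDPrev k C n) := by
  have h1 := totSingle_normN_counitHead_bprime n (totComp (n + 1) 1 n x)
  have h2 := sub_mem h1 (totUnshift_totD_sub_mem n x)
  rw [sub_sub_sub_cancel_right] at h2
  rwa [connesOperator, LinearMap.comp_apply, LinearMap.comp_apply, horizD_totComp_zero hx]

/-- The periodicity map `S : HC^n → HC^{n+2}`. -/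
noncomputable def cyclicS (k : Type u) [Field k] (C : Type v) [AddCommGroup C] [Module k C]
    [Coalgebra k C] (n : ℕ) : HCMod k C n →ₗ[k] HCMod k C (n + 2) :=
  kerModRangeMap (e := totDPrev k C n) (d := totD k C n) (e' := totDPrev k C (n + 2))
    (d' := totD k C (n + 2)) (totShift n)
    (fun x hx => by rw [totD_totShift, hx, map_zero])
    (fun y => by
      cases n with
      | zero =>
        rw [totDPrev, LinearMap.zero_apply, map_zero]
        exact zero_mem _
      | succ n => exact ⟨totShift n y, totD_totShift n y⟩)

/-- The map `I : HC^n → Hoch^n` induced by the projection to column zero. -/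
noncomputable def cyclicI (k : Type u) [Field k] (C : Type v) [AddCommGroup C] [Module k C]
    [Coalgebra k C] (n : ℕ) : HCMod k C n →ₗ[k] HochMod k C n :=
  kerModRangeMap (e := totDPrev k C n) (d := totD k C n) (e' := bHochPrev k C n)
    (d' := bHoch k C n) (totComp n 0 n)
    (fun x hx => bHoch_totComp_zero hx)
    (fun y => by
      cases n with
      | zero =>
        rw [totDPrev, LinearMap.zero_apply, map_zero]
        exact zero_mem _
      | succ n => exact ⟨totComp n 0 n y, (totComp_totD_zero n y).symm⟩)

/-- The map `B : Hoch^{n+1} → HC^n` induced by Connes' operator. -/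
noncomputable def cyclicB (k : Type u) [Field k] (C : Type v) [AddCommGroup C] [Module k C]
    [Coalgebra k C] (n : ℕ) : HochMod k C (n + 1) →ₗ[k] HCMod k C n :=
  kerModRangeMap (e := bHochPrev k C (n + 1)) (d := bHoch k C (n + 1)) (e' := totDPrev k C n)
    (d' := totD k C n) (totSingle n 0 n ∘ₗ connesOperator k C n)
    (fun x hx => totD_totSingle_connesOperator hx)
    (fun y => by
      have h := totSingle_normN_counitHead_bprime n (horizD k C 0 n y)
      rw [normN_horizD_zero, map_zero, sub_zero, bprime_horizD_zero] at h
      exact h)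

theorem ker_cyclicI_zero : LinearMap.ker (cyclicI k C 0) = ⊥ :=
  kerModRangeMap_ker_eq_bot _ _ fun x _ hx => by
    obtain ⟨y, hy⟩ := hx
    refine ⟨0, ?_⟩
    rw [map_zero]
    refine totComp_ext fun p q h => ?_
    obtain rfl : p = 0 := by omega
    obtain rfl : q = 0 := by omega
    rw [map_zero, ← hy, bHochPrev, LinearMap.zero_apply]

theorem range_cyclicI_zero : LinearMap.range (cyclicI k C 0) = ⊤ :=
  kerModRangeMap_range_eq_top _ _ fun y hy =>
    ⟨totSingle 0 0 0 y, by
      rw [totD_totSingle_zero, hy, horizD_zero_zero, LinearMap.zero_apply, map_zero, map_zero,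
        add_zero], (totComp_totSingle_self rfl y).symm⟩

/-- A total cocycle of degree `n + 2` whose column zero vanishes is cohomologous to one supported
in the columns `p ≥ 2`. -/
theorem exists_totShift_of_totComp_zero {n : ℕ} {x : TotObj k C (n + 2)}
    (hx : totD k C (n + 2) x = 0) (h0 : totComp (n + 2) 0 (n + 2) x = 0) :
    ∃ y, totD k C n y = 0 ∧ x - totShift n y ∈ LinearMap.range (totD k C (n + 1)) := by
  have hb : bprime k C (n + 1) (totComp (n + 2) 1 (n + 1) x) = 0 := by
    rw [← horizD_totComp_zero (by rw [hx, map_zero]), h0, map_zero]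
  set w := totSingle (n + 1) 1 n (counitHead n (totComp (n + 2) 1 (n + 1) x)) with hw
  have hDw := totD_totSingle_one n (counitHead n (totComp (n + 2) 1 (n + 1) x))
  rw [bprime_counitHead hb, ← hw] at hDw
  have hDDw : totD k C (n + 2) (totD k C (n + 1) w) = 0 := by
    rw [hDw, map_sub, totD_totShift, totD_totSingle_normN, totD_totSingle_one,
      bprime_counitHead hb, hb, map_zero, sub_zero, sub_self]
  have hs : totShift n (totUnshift n (x + totD k C (n + 1) w)) = x + totD k C (n + 1) w := by
    refine totShift_totUnshift ?_ ?_
    · rw [map_add, h0, hDw, map_sub, totComp_totShift_of_lt (by omega) (by omega),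
        totComp_totSingle_of_ne (by omega) (by omega), sub_zero, add_zero]
    · rw [map_add, hDw, map_sub, totComp_totShift_of_lt (by omega) (by omega),
        totComp_totSingle_self (by omega), zero_sub, add_neg_cancel]
  refine ⟨totUnshift n (x + totD k C (n + 1) w), totShift_injective _ ?_, -w, ?_⟩
  · rw [← totD_totShift, hs, map_add, hx, hDDw, map_zero, add_zero]
  · rw [hs, map_neg]; abel

theorem totD_totD_totSingle_zero (n : ℕ) (t : TP k C n) :
    totD k C (n + 1) (totD k C n (totSingle n 0 n t)) = 0 := by
  rw [totD_totSingle_zero, map_add, totD_totSingle_zero, totD_totSingle_one, bHoch_bHoch,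
    normN_horizD_zero, bprime_horizD_zero]
  simp only [map_zero]
  abel

theorem ker_cyclicI_one : LinearMap.ker (cyclicI k C 1) = ⊥ :=
  kerModRangeMap_ker_eq_bot _ _ fun x hx hI => by
    obtain ⟨(w : TP k C 0), (hw : bHoch k C 0 w = _)⟩ := hI
    refine ⟨totSingle 0 0 0 w, ?_⟩
    refine (totD_totSingle_zero 0 w).trans (totComp_ext fun p q h => ?_)
    rw [map_add]
    match p, h with
    | 0, h =>
      obtain rfl : q = 1 := by omega
      rw [totComp_totSingle_self h, totComp_totSingle_of_ne h (by omega), add_zero, hw]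
    | 1, h =>
      obtain rfl : q = 0 := by omega
      rw [totComp_totSingle_self h, totComp_totSingle_of_ne h (by omega), zero_add]
      apply bprime_zero_injective
      rw [bprime_horizD_zero, hw]
      exact horizD_totComp_zero (by rw [hx, map_zero])
    | p + 2, h => omega

theorem ker_cyclicI_eq_range_cyclicS (n : ℕ) :
    LinearMap.ker (cyclicI k C (n + 2)) = LinearMap.range (cyclicS k C n) :=
  kerModRangeMap_ker_eq_range _ _ _ _
    (fun y _ => by
      rw [totComp_totShift_of_lt (by omega) (by omega)]
      exact zero_mem _)
    (fun x hx hI => by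
      obtain ⟨(w : TP k C (n + 1)), (hw : bHoch k C (n + 1) w = _)⟩ := hI
      set v := totSingle (n + 1) 0 (n + 1) w with hv
      obtain ⟨y, hy, z, hz⟩ := exists_totShift_of_totComp_zero (x := x - totD k C (n + 1) v)
        (by rw [map_sub, hx, hv, totD_totD_totSingle_zero, sub_zero])
        (by rw [map_sub, totComp_totD_zero, hv, totComp_totSingle_self (by omega), hw, sub_self])
      refine ⟨y, hy, z + v, ?_⟩
      change totD k C (n + 1) (z + v) = _
      rw [map_add, hz]
      abel)

theorem ker_cyclicB_eq_range_cyclicI (n : ℕ) :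
    LinearMap.ker (cyclicB k C n) = LinearMap.range (cyclicI k C (n + 1)) :=
  kerModRangeMap_ker_eq_range _ _ _ _
    (fun y hy => by
      have h := totSingle_connesOperator_sub_mem (x := y) (by rw [hy, map_zero])
      rw [hy, map_zero, sub_zero] at h
      exact h)
    (fun x hx hB => by
      have hl := totD_lift hx
      set l := totSingle (n + 1) 0 (n + 1) x +
        totSingle (n + 1) 1 n (counitHead n (horizD k C 0 (n + 1) x)) with hlx
      have hl0 : totComp (n + 1) 0 (n + 1) l = x := by
        rw [hlx, map_add, totComp_totSingle_self (by omega),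
          totComp_totSingle_of_ne (by omega) (by omega), add_zero]
      obtain ⟨z, hz⟩ := hB
      rw [LinearMap.comp_apply] at hz
      cases n with
      | zero =>
        rw [totDPrev, LinearMap.zero_apply] at hz
        refine ⟨l, by rw [hl, ← hz, map_zero], ?_⟩
        rw [hl0, sub_self]
        exact zero_mem _
      | succ n =>
        change totD k C n z = _ at hz
        refine ⟨l - totShift n z, ?_, ?_⟩
        · rw [map_sub, hl, totD_totShift, hz, sub_self]
        · rw [map_sub, hl0, totComp_totShift_of_lt (by omega) (by omega), sub_zero, sub_self]
          exact zero_mem _)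

theorem ker_cyclicS_eq_range_cyclicB (n : ℕ) :
    LinearMap.ker (cyclicS k C n) = LinearMap.range (cyclicB k C n) :=
  kerModRangeMap_ker_eq_range _ _ _ _
    (fun y hy => ⟨_, totD_lift hy⟩)
    (fun x hx hS => by
      obtain ⟨(z : TotObj k C (n + 1)), (hz : totD k C (n + 1) z = _)⟩ := hS
      refine ⟨totComp (n + 1) 0 (n + 1) z, ?_, ?_⟩
      · rw [← totComp_totD_zero, hz, totComp_totShift_of_lt (by omega) (by omega)]
      · have h := totSingle_connesOperator_sub_mem (x := z)
          (by rw [hz, totComp_totShift_of_lt (by omega) (by omega)])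
        rw [hz, totUnshift_totShift] at h
        rw [← neg_sub]
        exact neg_mem h)

end SBI

/-- **SBI sequence.** For every coassociative counital coalgebra `C` over a field
`k` there are `k`-linear maps `S : HC^n(C) → HC^{n+2}(C)`, `I : HC^n(C) → Hoch^n(C)` and
`B : Hoch^{n+1}(C) → HC^n(C)` making the long sequence
`⋯ → HC^n → HC^{n+2} → Hoch^{n+2} → HC^{n+1} → HC^{n+3} → ⋯` exact at every spot.
(The maps `S`, `I`, `B` with source or target a negative-degree group — which is zero — carry
no data; exactness at the corresponding spots is expressed by the first three conjuncts:
`ker I₀ = ⊥`, `range I₀ = ⊤` and `ker I₁ = ⊥`.) -/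
theorem SBI_long_exact_sequence (k : Type u) [Field k] (C : Type v) [AddCommGroup C]
    [Module k C] [Coalgebra k C] :
    ∃ (S : ∀ n : ℕ, HCMod k C n →ₗ[k] HCMod k C (n + 2))
      (I : ∀ n : ℕ, HCMod k C n →ₗ[k] HochMod k C n)
      (B : ∀ n : ℕ, HochMod k C (n + 1) →ₗ[k] HCMod k C n),
      -- exactness at HC^0 (the incoming map S : HC^{-2} = 0 → HC^0 is zero)
      LinearMap.ker (I 0) = ⊥ ∧
      -- exactness at Hoch^0 (the outgoing map B : Hoch^0 → HC^{-1} = 0 is zero)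
      LinearMap.range (I 0) = ⊤ ∧
      -- exactness at HC^1 (the incoming map S : HC^{-1} = 0 → HC^1 is zero)
      LinearMap.ker (I 1) = ⊥ ∧
      -- exactness at HC^{n+2}: ker I = range S
      (∀ n : ℕ, LinearMap.ker (I (n + 2)) = LinearMap.range (S n)) ∧
      -- exactness at Hoch^{n+1}: ker B = range I
      (∀ n : ℕ, LinearMap.ker (B n) = LinearMap.range (I (n + 1))) ∧
      -- exactness at HC^n: ker S = range B
      (∀ n : ℕ, LinearMap.ker (S n) = LinearMap.range (B n)) := by
  exact ⟨cyclicS k C, cyclicI k C, cyclicB k C, ker_cyclicI_zero, range_cyclicI_zero,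
    ker_cyclicI_one, ker_cyclicI_eq_range_cyclicS, ker_cyclicB_eq_range_cyclicI,
    ker_cyclicS_eq_range_cyclicB⟩
end

section
/- Let k be a field, let φ : V → V' be a quasi-isomorphism of (ℤ-indexed) cochain complexes of k-vector spaces, and let C be any cochain complex of k-vector spaces. Then id_C ⊗ φ : C ⊗ V → C ⊗ V' is a quasi-isomorphism, where C ⊗ V denotes the total tensor product complex with (C ⊗ V)_r = ⊕_{p+q=r} C_p ⊗_k V_q and differential d(c⊗v) = d(c)⊗v + (−1)^{|c|} c⊗d(v). -/
open CategoryTheory MonoidalCategory HomologicalComplex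

universe u

section MonoidalInstances

variable {C : Type*} [Category C] [MonoidalCategory C] [Preadditive C] [MonoidalPreadditive C]

instance curriedTensor_additive : (curriedTensor C).Additive where
  map_add := by
    intros; ext Z; simp [curriedTensor, MonoidalPreadditive.add_whiskerRight]

instance curriedTensor_obj_additive (X : C) : ((curriedTensor C).obj X).Additive where
  map_add := by
    intros; simp [curriedTensor, MonoidalPreadditive.whiskerLeft_add]

end MonoidalInstances

section Helpers

open CategoryTheory.Limits CategoryTheory.Pretriangulated

/-- Every linear map between vector spaces has a generalized inverse. -/
lemma ModuleCat.exists_comp_comp_eq_self {k : Type u} [Field k] {M N : ModuleCat.{u} k}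
    (f : M ⟶ N) : ∃ g : N ⟶ M, f ≫ g ≫ f = f := by
  obtain ⟨s, hs⟩ := f.hom.rangeRestrict.exists_rightInverse_of_surjective
    f.hom.range_rangeRestrict
  obtain ⟨g, hg⟩ := s.exists_extend
  refine ⟨ModuleCat.ofHom g, ?_⟩
  ext x
  have h₁ : g (f.hom x) = s (f.hom.rangeRestrict x) :=
    LinearMap.congr_fun hg (f.hom.rangeRestrict x)
  have h₂ := congr_arg Subtype.val (LinearMap.congr_fun hs (f.hom.rangeRestrict x))
  simpa [h₁] using h₂

/-- An acyclic cochain complex of vector spaces is contractible. -/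
lemma CochainComplex.Acyclic.nonempty_homotopy_id_zero {k : Type u} [Field k]
    {K : CochainComplex (ModuleCat.{u} k) ℤ} (hK : K.Acyclic) :
    Nonempty (Homotopy (𝟙 K) 0) := by
  choose s hs using fun i j : ℤ ↦ ModuleCat.exists_comp_comp_eq_self (K.d i j)
  let h (i j : ℤ) (_ : (ComplexShape.up ℤ).Rel j i) : K.X i ⟶ K.X j :=
    (𝟙 _ - K.d i (i + 1) ≫ s i (i + 1)) ≫ s j i
  suffices 𝟙 K = Homotopy.nullHomotopicMap' h from
    ⟨(Homotopy.ofEq this).trans (Homotopy.nullHomotopy' h)⟩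
  ext1 n
  have hn : (ComplexShape.up ℤ).Rel (n - 1) n := by simp
  have hn' : (ComplexShape.up ℤ).Rel n (n + 1) := by simp
  have hexact := (K.exactAt_iff' (n - 1) n (n + 1) (by simp) (by simp)).1 (hK n)
  have hzero : (𝟙 (K.X n) - K.d n (n + 1) ≫ s n (n + 1)) ≫ K.d n (n + 1) = 0 := by
    simp [hs]
  obtain ⟨l, hl⟩ : ∃ l : K.X n ⟶ K.X (n - 1),
      l ≫ K.d (n - 1) n = 𝟙 (K.X n) - K.d n (n + 1) ≫ s n (n + 1) :=
    ⟨hexact.liftFromProjective _ hzero, hexact.liftFromProjective_comp _ hzero⟩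
  have hleft : ((𝟙 (K.X n) - K.d n (n + 1) ≫ s n (n + 1)) ≫ s (n - 1) n) ≫ K.d (n - 1) n =
      𝟙 (K.X n) - K.d n (n + 1) ≫ s n (n + 1) := by
    rw [← hl, Category.assoc, Category.assoc, hs]
  rw [Homotopy.nullHomotopicMap'_f hn hn']
  dsimp only [h]
  rw [hleft]
  simp

/-- A quasi-isomorphism between cochain complexes of vector spaces is a homotopy
equivalence. -/
lemma CochainComplex.exists_homotopyEquiv_of_quasiIso {k : Type u} [Field k]
    {K L : CochainComplex (ModuleCat.{u} k) ℤ} (f : K ⟶ L) [QuasiIso f] :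
    ∃ e : HomotopyEquiv K L, e.hom = f := by
  have hf : HomotopyCategory.quasiIso _ _ ((HomotopyCategory.quotient _ _).map f) :=
    (HomotopyCategory.quotient_map_mem_quasiIso_iff f).2
      ((HomologicalComplex.mem_quasiIso_iff f).2 inferInstance)
  rw [HomotopyCategory.quasiIso_eq_trW_subcategoryAcyclic, ObjectProperty.trW_iff] at hf
  obtain ⟨Z, g, h, hT, hZ⟩ := hf
  obtain ⟨Z, rfl⟩ := HomotopyCategory.quotient_obj_surjective Z
  rw [HomotopyCategory.quotient_obj_mem_subcategoryAcyclic_iff_acyclic] at hZ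
  have hiso : IsIso ((HomotopyCategory.quotient _ _).map f) :=
    (Triangle.isZero₃_iff_isIso₁ _ hT).1
      ((HomotopyCategory.isZero_quotient_obj_iff Z).2
        (CochainComplex.Acyclic.nonempty_homotopy_id_zero hZ))
  obtain ⟨e, he⟩ := (HomologicalComplex.isIso_quotient_map_iff_homotopyEquivalences f).1 hiso
  exact ⟨e, he⟩

variable {C : Type*} [Category C] [MonoidalCategory C] [Preadditive C]
  [(curriedTensor C).Additive] [∀ X : C, ((curriedTensor C).obj X).Additive]
  {I : Type*} [AddMonoid I] [DecidableEq I] {c : ComplexShape I} [c.TensorSigns]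

lemma HomologicalComplex.tensorHom_id (K L : HomologicalComplex C c) [HasTensor K L] :
    HomologicalComplex.tensorHom (𝟙 K) (𝟙 L) = 𝟙 (HomologicalComplex.tensorObj K L) := by
  ext
  simp

lemma HomologicalComplex.tensorHom_id_comp (K : HomologicalComplex C c)
    {L₁ L₂ L₃ : HomologicalComplex C c} [HasTensor K L₁] [HasTensor K L₂] [HasTensor K L₃]
    (f : L₁ ⟶ L₂) (g : L₂ ⟶ L₃) :
    HomologicalComplex.tensorHom (𝟙 K) (f ≫ g) =
      HomologicalComplex.tensorHom (𝟙 K) f ≫ HomologicalComplex.tensorHom (𝟙 K) g := by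
  ext
  simp

/-- Tensoring on the left with a complex preserves homotopy equivalences. -/
noncomputable def HomotopyEquiv.tensorLeft [HasZeroObject C] (K : CochainComplex C ℤ)
    {L₁ L₂ : CochainComplex C ℤ} [HasTensor K L₁] [HasTensor K L₂] (e : HomotopyEquiv L₁ L₂) :
    HomotopyEquiv (HomologicalComplex.tensorObj K L₁) (HomologicalComplex.tensorObj K L₂) where
  hom := HomologicalComplex.tensorHom (𝟙 K) e.hom
  inv := HomologicalComplex.tensorHom (𝟙 K) e.inv
  homotopyHomInvId :=
    (Homotopy.ofEq (tensorHom_id_comp K e.hom e.inv).symm).trans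
      ((mapBifunctorMapHomotopy₂ (𝟙 K) e.homotopyHomInvId _ _).trans
        (Homotopy.ofEq (HomologicalComplex.tensorHom_id K L₁)))
  homotopyInvHomId :=
    (Homotopy.ofEq (tensorHom_id_comp K e.inv e.hom).symm).trans
      ((mapBifunctorMapHomotopy₂ (𝟙 K) e.homotopyInvHomId _ _).trans
        (Homotopy.ofEq (HomologicalComplex.tensorHom_id K L₂)))

end Helpers

/-- Over a field `k`, if `φ : V → V'` is a quasi-isomorphism of cochain
complexes of `k`-vector spaces and `C` is any cochain complex of `k`-vector spaces, then
`id_C ⊗ φ : C ⊗ V → C ⊗ V'` is a quasi-isomorphism, where `C ⊗ V` is the total tensor product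
complex `(C ⊗ V)_r = ⊕_{p+q=r} C_p ⊗ V_q` with the Koszul sign convention on differentials. -/
theorem quasiIso_tensor_id (k : Type u) [Field k]
    (C V V' : CochainComplex (ModuleCat.{u} k) ℤ)
    (φ : V ⟶ V') [QuasiIso φ] :
    QuasiIso (HomologicalComplex.tensorHom (𝟙 C) φ) := by
  obtain ⟨e, rfl⟩ := CochainComplex.exists_homotopyEquiv_of_quasiIso φ
  exact (HomotopyEquiv.tensorLeft C e).quasiIso_hom
end
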